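/- arXiv:2312.11132 — 3 statements merged into one kernel-verified Lean document; each statement's English description precedes it below -/
import Mathlib

section
/- Let R : ℝ^d → ℝ be an asset exposure risk measure, let β be a real d×m matrix of full rank m with 1 ≤ m < d, and define S(w) = inf{ R(y) : βᵀy = w }. Then S is continuously differentiable on ℝ^m ∖ {0}, and for every w ≠ 0 its gradient is ∇S(w) = (βᵀβ)⁻¹βᵀ ∇R(β(βᵀβ)⁻¹w + u*(β(βᵀβ)⁻¹w)), where for z ∈ ℝ^d ∖ Im(β)^⊥, u*(z) denotes the unique minimizer of u ↦ R(z+u) over Im(β)^⊥. -/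
noncomputable section

open Matrix

/-- An asset exposure risk measure on `ℝ^d`: continuous, C¹ away from 0,
positively homogeneous, subadditive, positive on nonzero vectors, and
additive only under scaled exposures. -/
structure IsAssetRiskMeasure {d : ℕ} (R : (Fin d → ℝ) → ℝ) : Prop where
  continuous : Continuous R
  contDiffAt : ∀ y : Fin d → ℝ, y ≠ 0 → ContDiffAt ℝ 1 R y
  pos_hom : ∀ l : ℝ, 0 ≤ l → ∀ y, R (l • y) = l * R y
  subadd : ∀ y₁ y₂, R (y₁ + y₂) ≤ R y₁ + R y₂
  pos : ∀ y, y ≠ 0 → 0 < R y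
  add_eq : ∀ y₁ y₂, y₁ ≠ 0 → y₂ ≠ 0 →
    R (y₁ + y₂) = R y₁ + R y₂ → ∃ c : ℝ, 0 < c ∧ y₁ = c • y₂

open Filter Topology

namespace IsAssetRiskMeasure

variable {d : ℕ} {R : (Fin d → ℝ) → ℝ}

theorem exists_norm_le (hR : IsAssetRiskMeasure R) :
    ∃ c : ℝ, 0 < c ∧ ∀ y, c * ‖y‖ ≤ R y := by
  obtain ⟨c, hc, h⟩ := (isCompact_sphere (0 : Fin d → ℝ) 1).exists_forall_le'
    hR.continuous.continuousOn (a := 0) fun b hb => hR.pos b (by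
      rintro rfl
      simp at hb)
  refine ⟨c, hc, fun y => ?_⟩
  rcases eq_or_ne y 0 with rfl | hy
  · simpa using (hR.pos_hom 0 le_rfl 0).ge
  · have hn : 0 < ‖y‖ := norm_pos_iff.mpr hy
    have h1 := h (‖y‖⁻¹ • y) (by simp [norm_smul, hn.ne'])
    rw [hR.pos_hom _ (inv_nonneg.mpr hn.le)] at h1
    rwa [inv_mul_eq_div, le_div_iff₀ hn] at h1

theorem hasFDerivAt (hR : IsAssetRiskMeasure R) {y : Fin d → ℝ} (hy : y ≠ 0) :
    HasFDerivAt R (fderiv ℝ R y) y :=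
  ((hR.contDiffAt y hy).differentiableAt one_ne_zero).hasFDerivAt

theorem fderiv_le (hR : IsAssetRiskMeasure R) {y : Fin d → ℝ} (hy : y ≠ 0) (v : Fin d → ℝ) :
    fderiv ℝ R y v ≤ R v := by
  refine le_of_tendsto ((hR.hasFDerivAt hy).lim_real v) ?_
  filter_upwards [eventually_gt_atTop 0] with c hc
  have h := hR.subadd y (c⁻¹ • v)
  rw [hR.pos_hom _ (inv_nonneg.mpr hc.le), inv_mul_eq_div] at h
  rw [smul_eq_mul, ← le_div_iff₀' hc]
  linarith

theorem le_fderiv_self (hR : IsAssetRiskMeasure R) {y : Fin d → ℝ} (hy : y ≠ 0) :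
    R y ≤ fderiv ℝ R y y := by
  refine ge_of_tendsto ((hR.hasFDerivAt hy).lim_real y) ?_
  filter_upwards [eventually_gt_atTop 0] with c hc
  have h := hR.pos_hom (1 + c⁻¹) (by positivity) y
  rw [add_smul, one_smul] at h
  rw [h, smul_eq_mul]
  apply le_of_eq
  field_simp
  ring

theorem fderiv_self (hR : IsAssetRiskMeasure R) {y : Fin d → ℝ} (hy : y ≠ 0) :
    fderiv ℝ R y y = R y :=
  (hR.fderiv_le hy y).antisymm (hR.le_fderiv_self hy)

variable {F : Type*} [NormedAddCommGroup F] [NormedSpace ℝ F]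

/-- Minimizers of `R` over a fibre of a linear map not containing `0` are unique. -/
theorem eq_of_isMinOn_fiber (hR : IsAssetRiskMeasure R) (B : (Fin d → ℝ) →L[ℝ] F) {w : F}
    (hw : w ≠ 0) {y₁ y₂ : Fin d → ℝ} (h₁ : B y₁ = w) (h₂ : B y₂ = w)
    (hm₁ : ∀ y, B y = w → R y₁ ≤ R y) (hm₂ : ∀ y, B y = w → R y₂ ≤ R y) : y₁ = y₂ := by
  have hy₁ : y₁ ≠ 0 := by
    rintro rfl
    exact hw (by rw [← h₁, map_zero])
  have hy₂ : y₂ ≠ 0 := by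
    rintro rfl
    exact hw (by rw [← h₂, map_zero])
  have hmid : B ((1 / 2 : ℝ) • (y₁ + y₂)) = w := by
    rw [map_smul, map_add, h₁, h₂, ← two_smul ℝ w, smul_smul]
    norm_num
  have e₁ := hm₁ _ hmid
  have e₂ := hm₂ _ hmid
  rw [hR.pos_hom _ (by norm_num)] at e₁ e₂
  obtain ⟨c, -, rfl⟩ := hR.add_eq y₁ y₂ hy₁ hy₂
    (le_antisymm (hR.subadd _ _) (by linarith))
  rw [map_smul, h₂] at h₁
  have hc : c = 1 := smul_left_injective ℝ hw (by simpa using h₁)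
  rw [hc, one_smul]

theorem continuousAt_minimizer (hR : IsAssetRiskMeasure R) (B : (Fin d → ℝ) →L[ℝ] F)
    (L : F →L[ℝ] (Fin d → ℝ)) (hBL : ∀ w, B (L w) = w) (Y : F → (Fin d → ℝ))
    (hY : ∀ w, w ≠ 0 → B (Y w) = w)
    (hmin : ∀ w, w ≠ 0 → ∀ y, B y = w → R (Y w) ≤ R y) {w : F} (hw : w ≠ 0) :
    ContinuousAt Y w := by
  obtain ⟨c, hc, hcR⟩ := hR.exists_norm_le
  have hne : ∀ᶠ w' in 𝓝 w, w' ≠ 0 := isOpen_ne.mem_nhds hw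
  refine (isCompact_closedBall (0 : Fin d → ℝ)
    ((R (L w) + 1) / c)).tendsto_nhds_of_unique_mapClusterPt ?_ ?_
  · have hRL : ContinuousAt (fun w' => R (L w')) w :=
      (hR.continuous.comp L.continuous).continuousAt
    filter_upwards [hne, hRL.eventually_lt_const (lt_add_one _)] with w' hw' hlt
    rw [mem_closedBall_zero_iff, le_div_iff₀' hc]
    exact (hcR _).trans ((hmin w' hw' _ (hBL w')).trans hlt.le)
  · intro y _ hy
    obtain ⟨U, hU, hUy⟩ := mapClusterPt_iff_ultrafilter.mp hy
    have hneU : ∀ᶠ w' in (U : Filter F), w' ≠ 0 := hU hne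
    have hid : Tendsto (fun w' : F => w') U (𝓝 w) := hU
    have hBy : B y = w := by
      refine tendsto_nhds_unique ((B.continuous.tendsto y).comp hUy) (hid.congr' ?_)
      filter_upwards [hneU] with w' hw'
      exact (hY w' hw').symm
    refine hR.eq_of_isMinOn_fiber B hw hBy (hY w hw) (fun x hx => ?_) (hmin w hw)
    have hlim : Tendsto (fun w' => R (x + L (w' - w))) U (𝓝 (R x)) := by
      have hcont : Continuous fun w' => R (x + L (w' - w)) :=
        hR.continuous.comp (by fun_prop)
      simpa using (hcont.tendsto w).mono_left hU
    refine le_of_tendsto_of_tendsto ((hR.continuous.tendsto y).comp hUy) hlim ?_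
    filter_upwards [hneU] with w' hw'
    exact hmin w' hw' _ (by simp [hx, hBL])

/-- First-order optimality: the derivative at a fibre minimizer vanishes on the kernel. -/
theorem fderiv_eq_zero_of_ker (hR : IsAssetRiskMeasure R) (B : (Fin d → ℝ) →L[ℝ] F)
    {y : Fin d → ℝ} (hy : y ≠ 0) (hmin : ∀ x, B x = B y → R y ≤ R x)
    {v : Fin d → ℝ} (hv : B v = 0) : fderiv ℝ R y v = 0 := by
  have key : ∀ u, B u = 0 → 0 ≤ fderiv ℝ R y u := fun u hu => by
    refine ge_of_tendsto ((hR.hasFDerivAt hy).lim_real u) ?_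
    filter_upwards [eventually_gt_atTop 0] with c hc
    exact smul_nonneg hc.le (sub_nonneg.mpr (hmin _ (by simp [hu])))
  have h := key (-v) (by simp [hv])
  rw [map_neg] at h
  exact le_antisymm (by linarith) (key v hv)

theorem hasFDerivAt_fiber_min (hR : IsAssetRiskMeasure R) (B : (Fin d → ℝ) →L[ℝ] F)
    (L : F →L[ℝ] (Fin d → ℝ)) (hBL : ∀ w, B (L w) = w) (Y : F → (Fin d → ℝ))
    (hY : ∀ w, w ≠ 0 → B (Y w) = w)
    (hmin : ∀ w, w ≠ 0 → ∀ y, B y = w → R (Y w) ≤ R y) {w : F} (hw : w ≠ 0) :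
    HasFDerivAt (fun w => R (Y w)) ((fderiv ℝ R (Y w)).comp L) w := by
  have hy : Y w ≠ 0 := fun h => hw (by rw [← hY w hw, h, map_zero])
  have hne : ∀ᶠ w' in 𝓝 w, w' ≠ 0 := isOpen_ne.mem_nhds hw
  have hup : HasFDerivAt (fun w' => R (Y w + L (w' - w))) ((fderiv ℝ R (Y w)).comp L) w := by
    have hin : HasFDerivAt (fun w' => Y w + L (w' - w)) L w :=
      (L.hasFDerivAt.comp w ((hasFDerivAt_id w).sub_const w)).const_add (Y w)
    refine HasFDerivAt.comp w ?_ hin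
    simpa using hR.hasFDerivAt hy
  rw [hasFDerivAt_iff_isLittleO] at hup ⊢
  refine (Asymptotics.IsBigO.of_bound' ?_).trans_isLittleO hup
  filter_upwards [hne] with w' hw'
  have hle : R (Y w') ≤ R (Y w + L (w' - w)) := hmin w' hw' _ (by simp [hY w hw, hBL])
  have hker : fderiv ℝ R (Y w) (Y w' - (Y w + L (w' - w))) = 0 :=
    hR.fderiv_eq_zero_of_ker B hy (fun x hx => hmin w hw x (hx.trans (hY w hw)))
      (by simp [hY w hw, hY w' hw', hBL])
  have hge := hR.fderiv_le hy (Y w')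
  rw [map_sub, map_add, hR.fderiv_self hy] at hker
  simp only [sub_self, map_zero, add_zero, ContinuousLinearMap.comp_apply, Real.norm_eq_abs]
  exact abs_le_abs_of_nonneg (by linarith) (by linarith)

theorem contDiffAt_fiber_min (hR : IsAssetRiskMeasure R) (B : (Fin d → ℝ) →L[ℝ] F)
    (L : F →L[ℝ] (Fin d → ℝ)) (hBL : ∀ w, B (L w) = w) (Y : F → (Fin d → ℝ))
    (hY : ∀ w, w ≠ 0 → B (Y w) = w)
    (hmin : ∀ w, w ≠ 0 → ∀ y, B y = w → R (Y w) ≤ R y) {w : F} (hw : w ≠ 0) :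
    ContDiffAt ℝ 1 (fun w => R (Y w)) w := by
  rw [contDiffAt_one_iff]
  refine ⟨fun w => (fderiv ℝ R (Y w)).comp L, {0}ᶜ, isOpen_ne.mem_nhds hw, fun x hx => ?_,
    fun x hx => hR.hasFDerivAt_fiber_min B L hBL Y hY hmin hx⟩
  have hy : Y x ≠ 0 := fun h => hx (by rw [← hY x hx, h, map_zero]; rfl)
  have hc : ContinuousAt (fun w => fderiv ℝ R (Y w)) x :=
    ContinuousAt.comp (f := Y) ((hR.contDiffAt _ hy).continuousAt_fderiv one_ne_zero)
      (hR.continuousAt_minimizer B L hBL Y hY hmin hx)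
  exact (hc.clm_comp continuousAt_const).continuousWithinAt

end IsAssetRiskMeasure

theorem Matrix.isUnit_of_rank_eq {m : ℕ} {A : Matrix (Fin m) (Fin m) ℝ} (h : A.rank = m) :
    IsUnit A := by
  rw [← Matrix.mulVec_surjective_iff_isUnit, ← Matrix.coe_mulVecLin, ← LinearMap.range_eq_top]
  apply Submodule.eq_top_of_finrank_eq
  rw [← Matrix.rank, h, Module.finrank_fin_fun]

/-- S is continuously differentiable away from 0 with
∇S(w) = (βᵀβ)⁻¹βᵀ ∇R(β(βᵀβ)⁻¹w + u*(β(βᵀβ)⁻¹w)), where u*(z) is the unique minimizer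
of u ↦ R(z+u) over Im(β)^⊥ = ker(βᵀ). Partial derivatives are expressed via fderiv
in the coordinate directions. -/
theorem stmt_10 {d m : ℕ} (hm : 1 ≤ m) (hmd : m < d)
    (R : (Fin d → ℝ) → ℝ) (hR : IsAssetRiskMeasure R)
    (β : Matrix (Fin d) (Fin m) ℝ) (hrank : β.rank = m)
    (S : (Fin m → ℝ) → ℝ)
    (hS : ∀ w, S w = sInf (R '' {y : Fin d → ℝ | βᵀ *ᵥ y = w}))
    (ustar : (Fin d → ℝ) → (Fin d → ℝ))
    (hustar : ∀ z : Fin d → ℝ, βᵀ *ᵥ z ≠ 0 →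
      βᵀ *ᵥ ustar z = 0 ∧ ∀ u : Fin d → ℝ, βᵀ *ᵥ u = 0 → R (z + ustar z) ≤ R (z + u)) :
    ∀ w : Fin m → ℝ, w ≠ 0 →
      ContDiffAt ℝ 1 S w ∧
      ∀ i : Fin m,
        fderiv ℝ S w (Pi.single i 1) =
          (((βᵀ * β)⁻¹ * βᵀ) *ᵥ fun j : Fin d =>
            fderiv ℝ R
              (β *ᵥ ((βᵀ * β)⁻¹ *ᵥ w) + ustar (β *ᵥ ((βᵀ * β)⁻¹ *ᵥ w)))
              (Pi.single j 1)) i := by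
  have hunit : IsUnit (βᵀ * β).det :=
    (Matrix.isUnit_iff_isUnit_det _).mp
      (Matrix.isUnit_of_rank_eq (by rw [Matrix.rank_transpose_mul_self, hrank]))
  set B : (Fin d → ℝ) →L[ℝ] (Fin m → ℝ) := (Matrix.mulVecLin βᵀ).toContinuousLinearMap
  set L : (Fin m → ℝ) →L[ℝ] (Fin d → ℝ) :=
    (Matrix.mulVecLin (β * (βᵀ * β)⁻¹)).toContinuousLinearMap
  have hBv : ∀ y, B y = βᵀ *ᵥ y := fun _ => rfl
  have hLv : ∀ w, L w = β *ᵥ ((βᵀ * β)⁻¹ *ᵥ w) := fun w => by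
    rw [Matrix.mulVec_mulVec]
    rfl
  have hBL : ∀ w, B (L w) = w := fun w => by
    rw [hBv, hLv, Matrix.mulVec_mulVec, Matrix.mulVec_mulVec, Matrix.mul_nonsing_inv _ hunit,
      Matrix.one_mulVec]
  set Y : (Fin m → ℝ) → (Fin d → ℝ) := fun w => L w + ustar (L w) with hYdef
  have hu : ∀ w, w ≠ 0 → B (ustar (L w)) = 0 ∧
      ∀ u, B u = 0 → R (L w + ustar (L w)) ≤ R (L w + u) := fun w hw =>
    hustar (L w) (by rwa [← hBv, hBL])
  have hY : ∀ w, w ≠ 0 → B (Y w) = w := fun w hw => by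
    rw [hYdef, map_add, hBL, (hu w hw).1, add_zero]
  have hmin : ∀ w, w ≠ 0 → ∀ y, B y = w → R (Y w) ≤ R y := fun w hw y hy => by
    simpa using (hu w hw).2 (y - L w) (by rw [map_sub, hy, hBL, sub_self])
  intro w hw
  have hSY : S =ᶠ[𝓝 w] fun w => R (Y w) := by
    filter_upwards [isOpen_ne.mem_nhds hw] with w' hw'
    rw [hS]
    refine IsLeast.csInf_eq ⟨⟨Y w', hY w' hw', rfl⟩, ?_⟩
    rintro _ ⟨y, hy, rfl⟩
    exact hmin w' hw' y hy
  refine ⟨(hR.contDiffAt_fiber_min B L hBL Y hY hmin hw).congr_of_eventuallyEq hSY, fun i => ?_⟩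
  rw [hSY.fderiv_eq, (hR.hasFDerivAt_fiber_min B L hBL Y hY hmin hw).fderiv, ← hLv]
  have htr : (βᵀ * β)⁻¹ * βᵀ = (β * (βᵀ * β)⁻¹)ᵀ := by
    rw [Matrix.transpose_mul, Matrix.transpose_nonsing_inv, Matrix.transpose_mul,
      Matrix.transpose_transpose]
  have hcol : L (Pi.single i 1) = (β * (βᵀ * β)⁻¹).col i :=
    Matrix.mulVec_single_one (β * (βᵀ * β)⁻¹) i
  rw [htr, ContinuousLinearMap.comp_apply, hcol,
    pi_eq_sum_univ' ((β * (βᵀ * β)⁻¹).col i), map_sum]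
  simp [Matrix.mulVec, dotProduct, Y]
end
end

section
/- Let R : ℝ^d → ℝ be an asset exposure risk measure, β a real d×m matrix of full rank m with 1 ≤ m < d, S(w) = inf{ R(y) : βᵀy = w }, b ∈ Δ^{>0}_m, and g : ℝ₊ → ℝ continuously differentiable, convex and strictly increasing. Then the function Γ_g : (0,∞)^m → ℝ given by Γ_g(w) = g(S(w)) − Σ_{i=1}^m b_i·log(w_i) has a unique global minimizer w* on (0,∞)^m. -/
noncomputable section

open Matrix

lemma IsAssetRiskMeasure.map_zero {d : ℕ} {R : (Fin d → ℝ) → ℝ}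
    (hR : IsAssetRiskMeasure R) : R 0 = 0 := by
  simpa using hR.pos_hom 0 le_rfl 0

lemma IsAssetRiskMeasure.nonneg {d : ℕ} {R : (Fin d → ℝ) → ℝ}
    (hR : IsAssetRiskMeasure R) (y : Fin d → ℝ) : 0 ≤ R y := by
  by_cases h : y = 0
  · rw [h, hR.map_zero]
  · exact (hR.pos y h).le

/-- A risk measure dominates a positive multiple of the norm. -/
lemma IsAssetRiskMeasure.exists_mul_norm_le {d : ℕ} {R : (Fin d → ℝ) → ℝ}
    (hR : IsAssetRiskMeasure R) : ∃ r : ℝ, 0 < r ∧ ∀ y, r * ‖y‖ ≤ R y := by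
  obtain ⟨r, hr, h⟩ := (isCompact_sphere (0 : Fin d → ℝ) 1).exists_forall_le'
    hR.continuous.continuousOn (a := 0) (fun y hy => hR.pos y (by
      rintro rfl
      simp at hy))
  refine ⟨r, hr, fun y => ?_⟩
  by_cases hy : y = 0
  · simp [hy, hR.map_zero]
  have hn : 0 < ‖y‖ := norm_pos_iff.mpr hy
  have h1 := h (‖y‖⁻¹ • y) (by simp [norm_smul, hn.ne'])
  rw [hR.pos_hom _ (by positivity)] at h1
  calc r * ‖y‖ ≤ (‖y‖⁻¹ * R y) * ‖y‖ := by gcongr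
    _ = R y := by field_simp

lemma Matrix.exists_transpose_mulVec_eq_of_rank_eq {d m : ℕ} (β : Matrix (Fin d) (Fin m) ℝ)
    (hrank : β.rank = m) (w : Fin m → ℝ) : ∃ y, βᵀ *ᵥ y = w := by
  have h : LinearMap.range βᵀ.mulVecLin = ⊤ := by
    apply Submodule.eq_top_of_finrank_eq
    have := Matrix.rank_transpose β
    rw [Matrix.rank] at this
    simp [this, hrank]
  obtain ⟨y, hy⟩ := LinearMap.range_eq_top.mp h w
  exact ⟨y, hy⟩

/-- The factor risk measure induced by an asset exposure risk measure. -/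
def factorRisk {d m : ℕ} (R : (Fin d → ℝ) → ℝ) (β : Matrix (Fin d) (Fin m) ℝ)
    (w : Fin m → ℝ) : ℝ :=
  sInf (R '' {y : Fin d → ℝ | βᵀ *ᵥ y = w})

section factorRisk

variable {d m : ℕ} {R : (Fin d → ℝ) → ℝ} {β : Matrix (Fin d) (Fin m) ℝ}

lemma factorRisk_nonneg (hR : IsAssetRiskMeasure R) (w : Fin m → ℝ) :
    0 ≤ factorRisk R β w := by
  apply Real.sInf_nonneg
  rintro _ ⟨y, -, rfl⟩
  exact hR.nonneg y

lemma factorRisk_le (hR : IsAssetRiskMeasure R) (y : Fin d → ℝ) :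
    factorRisk R β (βᵀ *ᵥ y) ≤ R y :=
  csInf_le ⟨0, by rintro _ ⟨z, -, rfl⟩; exact hR.nonneg z⟩ ⟨y, rfl, rfl⟩

lemma exists_lt_factorRisk_add (hrank : β.rank = m) (w : Fin m → ℝ) {ε : ℝ} (hε : 0 < ε) :
    ∃ y, βᵀ *ᵥ y = w ∧ R y < factorRisk R β w + ε := by
  obtain ⟨y₀, hy₀⟩ := β.exists_transpose_mulVec_eq_of_rank_eq hrank w
  obtain ⟨_, ⟨y, hy, rfl⟩, hlt⟩ := exists_lt_of_csInf_lt
    (⟨R y₀, y₀, hy₀, rfl⟩ : (R '' {y : Fin d → ℝ | βᵀ *ᵥ y = w}).Nonempty)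
    (lt_add_of_pos_right (factorRisk R β w) hε)
  exact ⟨y, hy, hlt⟩

lemma convexOn_factorRisk (hR : IsAssetRiskMeasure R) (hrank : β.rank = m) :
    ConvexOn ℝ Set.univ (factorRisk R β) := by
  refine ⟨convex_univ, fun w _ v _ s t hs ht hst => le_of_forall_pos_le_add fun ε hε => ?_⟩
  obtain ⟨y, rfl, hy⟩ := exists_lt_factorRisk_add (R := R) hrank w hε
  obtain ⟨z, rfl, hz⟩ := exists_lt_factorRisk_add (R := R) hrank v hε
  have h1 := factorRisk_le (β := β) hR (s • y + t • z)
  rw [Matrix.mulVec_add, Matrix.mulVec_smul, Matrix.mulVec_smul] at h1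
  have h2 := hR.subadd (s • y) (t • z)
  rw [hR.pos_hom s hs, hR.pos_hom t ht] at h2
  have h3 := mul_le_mul_of_nonneg_left hy.le hs
  have h4 := mul_le_mul_of_nonneg_left hz.le ht
  have h5 : s * ε + t * ε = ε := by rw [← add_mul, hst, one_mul]
  simp only [smul_eq_mul]
  linarith

lemma continuous_factorRisk (hR : IsAssetRiskMeasure R) (hrank : β.rank = m) :
    Continuous (factorRisk R β) :=
  continuousOn_univ.mp ((convexOn_factorRisk hR hrank).continuousOn isOpen_univ)

lemma exists_mul_norm_le_factorRisk (hR : IsAssetRiskMeasure R) (hrank : β.rank = m) :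
    ∃ c : ℝ, 0 < c ∧ ∀ w, c * ‖w‖ ≤ factorRisk R β w := by
  obtain ⟨r, hr, h⟩ := hR.exists_mul_norm_le
  set L := LinearMap.toContinuousLinearMap βᵀ.mulVecLin with hL
  have hLpos : 0 < ‖L‖ + 1 := by positivity
  refine ⟨r / (‖L‖ + 1), by positivity, fun w => le_of_forall_pos_le_add fun ε hε => ?_⟩
  obtain ⟨y, rfl, hy⟩ := exists_lt_factorRisk_add (R := R) hrank w hε
  have h1 : ‖βᵀ *ᵥ y‖ ≤ (‖L‖ + 1) * ‖y‖ := by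
    have : ‖βᵀ *ᵥ y‖ ≤ ‖L‖ * ‖y‖ := L.le_opNorm y
    nlinarith [norm_nonneg y]
  calc r / (‖L‖ + 1) * ‖βᵀ *ᵥ y‖ ≤ r / (‖L‖ + 1) * ((‖L‖ + 1) * ‖y‖) := by gcongr
    _ = r * ‖y‖ := by field_simp
    _ ≤ R y := h y
    _ ≤ _ := hy.le

end factorRisk

/-- A strictly increasing convex function on `[0, ∞)` grows at least linearly. -/
lemma ConvexOn.exists_linear_le_of_strictMonoOn {g : ℝ → ℝ} (hg : ConvexOn ℝ (Set.Ici 0) g)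
    (hmono : StrictMonoOn g (Set.Ici 0)) :
    ∃ a A : ℝ, 0 < a ∧ ∀ s, 0 ≤ s → A + a * s ≤ g s := by
  have h01 : g 0 < g 1 := hmono (by simp) (by simp) one_pos
  refine ⟨g 1 - g 0, g 0 - (g 1 - g 0), sub_pos.mpr h01, fun s hs => ?_⟩
  rcases le_total s 1 with h | h
  · have h0 : g 0 ≤ g s := hmono.monotoneOn (by simp) hs hs
    nlinarith
  · have hs0 : 0 < s := by linarith
    have hc := hg.2 (Set.self_mem_Ici (a := (0 : ℝ))) (Set.mem_Ici.mpr hs)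
      (sub_nonneg.mpr (inv_le_one_of_one_le₀ h)) (inv_nonneg.mpr hs) (sub_add_cancel 1 s⁻¹)
    simp only [smul_eq_mul, mul_zero, zero_add, inv_mul_cancel₀ hs0.ne'] at hc
    have := mul_le_mul_of_nonneg_right hc hs
    have e : ((1 - s⁻¹) * g 0 + s⁻¹ * g s) * s = (s - 1) * g 0 + g s := by
      field_simp
    rw [e] at this
    nlinarith

lemma one_add_log_le_mul_sub_log {c t : ℝ} (hc : 0 < c) (ht : 0 < t) :
    1 + Real.log c ≤ c * t - Real.log t := by
  have := Real.log_le_sub_one_of_pos (mul_pos hc ht)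
  rw [Real.log_mul hc.ne' ht.ne'] at this
  linarith

/-- Sublevel sets of `t ↦ c * t - log t` are bounded and bounded away from zero. -/
lemma exists_bounds_of_mul_sub_log_le {c : ℝ} (hc : 0 < c) (K : ℝ) :
    ∃ ε M : ℝ, 0 < ε ∧ ∀ t, 0 < t → c * t - Real.log t ≤ K → ε ≤ t ∧ t ≤ M := by
  refine ⟨Real.exp (-K), (K - (1 + Real.log (c / 2))) / (c / 2), Real.exp_pos _,
    fun t ht h => ⟨?_, ?_⟩⟩
  · rw [← Real.le_log_iff_exp_le ht]
    nlinarith [mul_pos hc ht]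
  · rw [le_div_iff₀ (by positivity)]
    have := one_add_log_le_mul_sub_log (half_pos hc) ht
    linarith

/-- A continuous function on the open positive orthant which dominates
`A + ∑ i, b i * (c * w i - log (w i))` attains its minimum. -/
lemma exists_forall_le_of_sum_log_le {m : ℕ} {b : Fin m → ℝ} (hb : ∀ i, 0 < b i)
    {f : (Fin m → ℝ) → ℝ} (hf : ContinuousOn f {w | ∀ i, 0 < w i}) {A c : ℝ} (hc : 0 < c)
    (hle : ∀ w : Fin m → ℝ, (∀ i, 0 < w i) →
      A + ∑ i, b i * (c * w i - Real.log (w i)) ≤ f w) :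
    ∃ w : Fin m → ℝ, (∀ i, 0 < w i) ∧ ∀ v : Fin m → ℝ, (∀ i, 0 < v i) → f w ≤ f v := by
  set l := 1 + Real.log c with hl
  have key : ∀ w : Fin m → ℝ, (∀ i, 0 < w i) → f w ≤ f 1 → ∀ i,
      c * w i - Real.log (w i) ≤ (f 1 - A - ∑ j, b j * l) / b i + l := by
    intro w hw hw1 i
    have h1 := hle w hw
    have h2 : b i * (c * w i - Real.log (w i) - l) ≤
        ∑ j, b j * (c * w j - Real.log (w j) - l) :=
      Finset.single_le_sum (f := fun j => b j * (c * w j - Real.log (w j) - l))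
        (fun j _ => mul_nonneg (hb j).le
          (sub_nonneg.mpr (one_add_log_le_mul_sub_log hc (hw j)))) (Finset.mem_univ i)
    simp only [mul_sub _ _ l, Finset.sum_sub_distrib] at h2
    rw [← sub_le_iff_le_add, le_div_iff₀ (hb i)]
    linarith
  choose ε M hε hbd using fun i => exists_bounds_of_mul_sub_log_le hc
    ((f 1 - A - ∑ j, b j * l) / b i + l)
  have hbox : ∀ w : Fin m → ℝ, (∀ i, 0 < w i) → f w ≤ f 1 → w ∈ Set.Icc ε M :=
    fun w hw hw1 => ⟨fun i => (hbd i _ (hw i) (key w hw hw1 i)).1,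
      fun i => (hbd i _ (hw i) (key w hw hw1 i)).2⟩
  have h1 : (1 : Fin m → ℝ) ∈ Set.Icc ε M := hbox 1 (fun _ => one_pos) le_rfl
  have hpos : ∀ w ∈ Set.Icc ε M, ∀ i, 0 < w i := fun w hw i => (hε i).trans_le (hw.1 i)
  obtain ⟨w, hw, hmin⟩ := isCompact_Icc.exists_isMinOn ⟨1, h1⟩ (hf.mono hpos)
  refine ⟨w, hpos w hw, fun v hv => ?_⟩
  rcases le_total (f v) (f 1) with h | h
  · exact hmin (hbox v hv h)
  · exact (hmin h1).trans h

lemma strictConvexOn_neg_sum_mul_log {m : ℕ} {b : Fin m → ℝ} (hb : ∀ i, 0 < b i) :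
    StrictConvexOn ℝ {w : Fin m → ℝ | ∀ i, 0 < w i} (fun w => -∑ i, b i * Real.log (w i)) := by
  refine ⟨?_, fun w hw v hv hne s t hs ht hst => ?_⟩
  · intro w hw v hv s t hs ht hst i
    exact convex_Ioi (0 : ℝ) (hw i) (hv i) hs ht hst
  · obtain ⟨j, hj⟩ := Function.ne_iff.mp hne
    have hlt : ∑ i, (s * (b i * Real.log (w i)) + t * (b i * Real.log (v i))) <
        ∑ i, b i * Real.log ((s • w + t • v) i) := by
      refine Finset.sum_lt_sum (fun i _ => ?_) ⟨j, Finset.mem_univ j, ?_⟩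
      · have := mul_le_mul_of_nonneg_left
          (strictConcaveOn_log_Ioi.concaveOn.2 (hw i) (hv i) hs.le ht.le hst) (hb i).le
        simp only [smul_eq_mul, Pi.add_apply, Pi.smul_apply] at this ⊢
        linarith
      · have := mul_lt_mul_of_pos_left
          (strictConcaveOn_log_Ioi.2 (hw j) (hv j) hj hs ht hst) (hb j)
        simp only [smul_eq_mul, Pi.add_apply, Pi.smul_apply] at this ⊢
        linarith
    rw [Finset.sum_add_distrib, ← Finset.mul_sum, ← Finset.mul_sum] at hlt
    simp only [smul_eq_mul]
    linarith

/-- Γ_g(w) = g(S(w)) − Σᵢ bᵢ log wᵢ has a unique global minimizer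
on (0,∞)^m. -/
theorem stmt_17 {d m : ℕ} (hm : 1 ≤ m) (hmd : m < d)
    (R : (Fin d → ℝ) → ℝ) (hR : IsAssetRiskMeasure R)
    (β : Matrix (Fin d) (Fin m) ℝ) (hrank : β.rank = m)
    (S : (Fin m → ℝ) → ℝ)
    (hS : ∀ w, S w = sInf (R '' {y : Fin d → ℝ | βᵀ *ᵥ y = w}))
    (b : Fin m → ℝ) (hb : ∀ i, 0 < b i) (hb1 : ∑ i, b i = 1)
    (g : ℝ → ℝ) (hg1 : ContDiffOn ℝ 1 g (Set.Ici 0))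
    (hg2 : ConvexOn ℝ (Set.Ici 0) g) (hg3 : StrictMonoOn g (Set.Ici 0)) :
    ∃! w : Fin m → ℝ, (∀ i, 0 < w i) ∧
      ∀ v : Fin m → ℝ, (∀ i, 0 < v i) →
        g (S w) - ∑ i, b i * Real.log (w i) ≤ g (S v) - ∑ i, b i * Real.log (v i) := by
  obtain rfl : S = factorRisk R β := funext hS
  have hS0 := factorRisk_nonneg (β := β) hR
  have hconv : ConvexOn ℝ {w : Fin m → ℝ | ∀ i, 0 < w i} (fun w => g (factorRisk R β w)) := by
    refine ⟨(strictConvexOn_neg_sum_mul_log hb).1, fun w _ v _ s t hs ht hst => ?_⟩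
    have h := (convexOn_factorRisk hR hrank).2 (Set.mem_univ w) (Set.mem_univ v) hs ht hst
    exact (hg3.monotoneOn (hS0 _) ((hS0 _).trans h) h).trans
      (hg2.2 (hS0 w) (hS0 v) hs ht hst)
  have hstrict := hconv.add_strictConvexOn (strictConvexOn_neg_sum_mul_log hb)
  have hcont : ContinuousOn (fun w : Fin m → ℝ => g (factorRisk R β w) -
      ∑ i, b i * Real.log (w i)) {w | ∀ i, 0 < w i} := by
    refine (hg1.continuousOn.comp (continuous_factorRisk hR hrank).continuousOn
      fun w _ => hS0 w).sub ?_
    exact continuousOn_finsetSum _ fun i _ => continuousOn_const.mul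
      ((continuous_apply i).continuousOn.log fun w hw => (hw i).ne')
  obtain ⟨a, A, ha, hlin⟩ := hg2.exists_linear_le_of_strictMonoOn hg3
  obtain ⟨c, hc, hnorm⟩ := exists_mul_norm_le_factorRisk hR hrank
  obtain ⟨w, hw, hmin⟩ := exists_forall_le_of_sum_log_le hb hcont (A := A) (mul_pos ha hc) (by
    intro w hw
    have h1 : ∑ i, b i * w i ≤ ‖w‖ := by
      calc ∑ i, b i * w i ≤ ∑ i, b i * ‖w‖ := Finset.sum_le_sum fun i _ =>
            mul_le_mul_of_nonneg_left ((le_abs_self _).trans (norm_le_pi_norm w i)) (hb i).le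
        _ = ‖w‖ := by rw [← Finset.sum_mul, hb1, one_mul]
    have h2 := hlin _ (hS0 w)
    have h3 := mul_le_mul_of_nonneg_left (hnorm w) ha.le
    have h4 := mul_le_mul_of_nonneg_left h1 (mul_pos ha hc).le
    have h5 : ∑ i, b i * (a * c * w i - Real.log (w i)) =
        a * c * ∑ i, b i * w i - ∑ i, b i * Real.log (w i) := by
      rw [Finset.mul_sum, ← Finset.sum_sub_distrib]
      exact Finset.sum_congr rfl fun i _ => by ring
    rw [h5]
    linarith)
  refine ⟨w, ⟨hw, hmin⟩, fun v ⟨hv, hvmin⟩ => hstrict.eq_of_isMinOn ?_ ?_ hv hw⟩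
  · exact isMinOn_iff.mpr fun u hu => by simpa [sub_eq_add_neg] using hvmin u hu
  · exact isMinOn_iff.mpr fun u hu => by simpa [sub_eq_add_neg] using hmin u hu
end
end

section
/- Let R : ℝ^d → ℝ be an asset exposure risk measure, β a real d×m matrix of full rank m with 1 ≤ m < d, S(w) = inf{ R(y) : βᵀy = w }, b ∈ Δ^{>0}_m, and g : ℝ₊ → ℝ continuously differentiable, convex and strictly increasing. Let w* be the unique minimizer on (0,∞)^m of Γ_g(w) = g(S(w)) − Σ_{i=1}^m b_i·log(w_i), and let y*(w*) be the unique point with βᵀy*(w*) = w* and R(y*(w*)) = S(w*). Then for every y ∈ y*(w*) + Im(β)^⊥ with Σ_{i=1}^d y_i > 0, the normalized vector θ = y/(Σ_{i=1}^d y_i) solves the Factor Risk Budgeting problem FRB_b: the factor exposure vector w = βᵀθ has all coordinates strictly positive and satisfies w_i·∂_iS(w) = b_i·S(w) for every i ∈ {1,…,m}. -/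
noncomputable section

open Matrix

theorem Matrix.exists_rightInverse_mulVec_transpose {d m : ℕ}
    (β : Matrix (Fin d) (Fin m) ℝ) (hrank : β.rank = m) :
    ∃ L : (Fin m → ℝ) →L[ℝ] (Fin d → ℝ), ∀ v, βᵀ *ᵥ L v = v := by
  have hr : LinearMap.range βᵀ.mulVecLin = ⊤ := by
    apply Submodule.eq_top_of_finrank_eq
    have h : βᵀ.rank = m := by rw [Matrix.rank_transpose, hrank]
    rw [Matrix.rank] at h
    simpa using h
  obtain ⟨L, hL⟩ := βᵀ.mulVecLin.exists_rightInverse_of_surjective hr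
  exact ⟨LinearMap.toContinuousLinearMap L, LinearMap.congr_fun hL⟩

/-- A function squeezed between two functions that touch it at a point and have the same
derivative there is differentiable at that point. -/
theorem HasFDerivAt.of_le_of_le {E : Type*} [NormedAddCommGroup E] [NormedSpace ℝ E]
    {lo f hi : E → ℝ} {A : E →L[ℝ] ℝ} {x : E}
    (hlo : HasFDerivAt lo A x) (hhi : HasFDerivAt hi A x)
    (hlof : ∀ v, lo v ≤ f v) (hfhi : ∀ v, f v ≤ hi v)
    (hlox : lo x = f x) (hhix : hi x = f x) : HasFDerivAt f A x := by
  rw [hasFDerivAt_iff_isLittleO] at hlo hhi ⊢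
  refine Asymptotics.IsBigO.trans_isLittleO ?_ (hlo.norm_left.add hhi.norm_left)
  refine Asymptotics.IsBigO.of_bound 1 (Filter.Eventually.of_forall fun v => ?_)
  rw [one_mul]
  simp only [Real.norm_eq_abs]
  rw [abs_of_nonneg (a := _ + _) (by positivity), abs_le]
  have h1 := hlof v
  have h2 := hfhi v
  rw [hlox, hhix]
  have h3 := neg_abs_le (lo v - f x - A (v - x))
  have h4 := le_abs_self (hi v - f x - A (v - x))
  have h5 := abs_nonneg (lo v - f x - A (v - x))
  have h6 := abs_nonneg (hi v - f x - A (v - x))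
  constructor <;> linarith

/-- A derivative of a positively homogeneous function satisfies the Euler identity. -/
theorem HasFDerivAt.apply_self_of_pos_hom {E : Type*} [NormedAddCommGroup E] [NormedSpace ℝ E]
    {f : E → ℝ} {A : E →L[ℝ] ℝ} {x : E} (hf : HasFDerivAt f A x)
    (hom : ∀ c : ℝ, 0 < c → ∀ v, f (c • v) = c * f v) : A x = f x := by
  have hc : HasDerivAt (fun t : ℝ => t • x) x 1 := by
    simpa using (hasDerivAt_id (1 : ℝ)).smul_const x
  have h1 : HasDerivAt (fun t : ℝ => f (t • x)) (A x) 1 :=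
    HasFDerivAt.comp_hasDerivAt (1 : ℝ) (by simpa using hf) hc
  have h2 : HasDerivAt (fun t : ℝ => t * f x) (f x) 1 := by
    simpa using (hasDerivAt_id (1 : ℝ)).mul_const (f x)
  refine h1.unique (h2.congr_of_eventuallyEq ?_)
  filter_upwards [lt_mem_nhds (zero_lt_one' ℝ)] with t ht using hom t ht x

/-- The derivative of a positively homogeneous function is invariant under positive scaling. -/
theorem HasFDerivAt.smul_of_pos_hom {E : Type*} [NormedAddCommGroup E] [NormedSpace ℝ E]
    {f : E → ℝ} {A : E →L[ℝ] ℝ} {x : E} (hf : HasFDerivAt f A x)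
    (hom : ∀ c : ℝ, 0 < c → ∀ v, f (c • v) = c * f v) {c : ℝ} (hc : 0 < c) :
    HasFDerivAt f A (c • x) := by
  have hscale : HasFDerivAt (fun v : E => c⁻¹ • v) (c⁻¹ • ContinuousLinearMap.id ℝ E) (c • x) :=
    (hasFDerivAt_id (c • x)).const_smul c⁻¹
  have hf' : HasFDerivAt f A (c⁻¹ • c • x) := by rwa [inv_smul_smul₀ hc.ne']
  have h := (hf'.comp (c • x) hscale).const_mul c
  have hA : c • A.comp (c⁻¹ • ContinuousLinearMap.id ℝ E) = A := by
    ext v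
    simp [hc.ne']
  rw [hA] at h
  refine h.congr_of_eventuallyEq (Filter.Eventually.of_forall fun v => ?_)
  simp [hom c⁻¹ (inv_pos.2 hc) v, hc.ne']

namespace IsAssetRiskMeasure

variable {d m : ℕ} {R : (Fin d → ℝ) → ℝ}

theorem nonneg_s18 (hR : IsAssetRiskMeasure R) (y : Fin d → ℝ) : 0 ≤ R y := by
  rcases eq_or_ne y 0 with rfl | hy
  · have := hR.pos_hom 0 le_rfl 0
    simp at this
    exact this.ge
  · exact (hR.pos y hy).le

theorem sInf_image_le (hR : IsAssetRiskMeasure R) (s : Set (Fin d → ℝ)) {y : Fin d → ℝ}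
    (hy : y ∈ s) : sInf (R '' s) ≤ R y :=
  csInf_le ⟨0, by rintro _ ⟨z, -, rfl⟩; exact hR.nonneg_s18 z⟩ ⟨y, hy, rfl⟩

variable {β : Matrix (Fin d) (Fin m) ℝ} {S : (Fin m → ℝ) → ℝ}
  {L : (Fin m → ℝ) →L[ℝ] (Fin d → ℝ)}

theorem factor_pos_hom (hR : IsAssetRiskMeasure R) (hL : ∀ v, βᵀ *ᵥ L v = v)
    (hS : ∀ w, S w = sInf (R '' {y : Fin d → ℝ | βᵀ *ᵥ y = w}))
    (c : ℝ) (hc : 0 < c) (v : Fin m → ℝ) : S (c • v) = c * S v := by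
  have key : ∀ c : ℝ, 0 < c → ∀ v, S (c • v) ≤ c * S v := by
    intro c hc v
    rw [← inv_mul_le_iff₀ hc, hS v]
    refine le_csInf ⟨_, L v, hL v, rfl⟩ ?_
    rintro _ ⟨y, hy, rfl⟩
    rw [inv_mul_le_iff₀ hc, ← hR.pos_hom c hc.le, hS]
    refine hR.sInf_image_le _ ?_
    have hy' : βᵀ *ᵥ y = v := hy
    simp [Matrix.mulVec_smul, hy']
  refine le_antisymm (key c hc v) ?_
  have h := key c⁻¹ (inv_pos.2 hc) (c • v)
  rwa [inv_smul_smul₀ hc.ne', ← div_eq_inv_mul, le_div_iff₀' hc] at h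

theorem factor_subadd (hR : IsAssetRiskMeasure R) (hL : ∀ v, βᵀ *ᵥ L v = v)
    (hS : ∀ w, S w = sInf (R '' {y : Fin d → ℝ | βᵀ *ᵥ y = w}))
    (u v : Fin m → ℝ) : S (u + v) ≤ S u + S v := by
  rw [← sub_le_iff_le_add, hS u]
  refine le_csInf ⟨_, L u, hL u, rfl⟩ ?_
  rintro _ ⟨x, hx, rfl⟩
  rw [sub_le_comm, hS v]
  refine le_csInf ⟨_, L v, hL v, rfl⟩ ?_
  rintro _ ⟨y, hy, rfl⟩
  rw [sub_le_iff_le_add', hS]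
  refine (hR.sInf_image_le _ ?_).trans (hR.subadd x y)
  have hx' : βᵀ *ᵥ x = u := hx
  have hy' : βᵀ *ᵥ y = v := hy
  simp [Matrix.mulVec_add, hx', hy']

/-- The factor risk measure is differentiable wherever it is attained at a nonzero exposure. -/
theorem factor_differentiableAt (hR : IsAssetRiskMeasure R) (hL : ∀ v, βᵀ *ᵥ L v = v)
    (hS : ∀ w, S w = sInf (R '' {y : Fin d → ℝ | βᵀ *ᵥ y = w}))
    {y : Fin d → ℝ} {w : Fin m → ℝ} (hy : y ≠ 0) (hyw : βᵀ *ᵥ y = w) (hRS : R y = S w) :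
    DifferentiableAt ℝ S w := by
  have hRy : HasFDerivAt R (fderiv ℝ R y) (y + L (w - w)) := by
    simpa using ((hR.contDiffAt y hy).differentiableAt one_ne_zero).hasFDerivAt
  have haff : HasFDerivAt (fun v => y + L (v - w)) L w := by
    simpa using (L.hasFDerivAt.comp w ((hasFDerivAt_id w).sub_const w)).const_add y
  have hhi := hRy.comp w haff
  have hRy' : HasFDerivAt R (fderiv ℝ R y) (y - L (w - w)) := by simpa using hRy
  have haff' : HasFDerivAt (fun v => y - L (v - w)) (-L) w := by
    simpa using (L.hasFDerivAt.comp w ((hasFDerivAt_id w).sub_const w)).const_sub y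
  have hlo := (hRy'.comp w haff').const_sub (2 * S w)
  rw [ContinuousLinearMap.comp_neg, neg_neg] at hlo
  have hle : ∀ v, S v ≤ R (y + L (v - w)) := fun v => by
    rw [hS v]
    refine hR.sInf_image_le _ ?_
    rw [Set.mem_ofPred_eq, Matrix.mulVec_add, hyw, hL, add_sub_cancel]
  refine (HasFDerivAt.of_le_of_le hlo hhi (fun v => ?_) hle ?_ ?_).differentiableAt
  · have h1 := hR.factor_subadd hL hS v ((2 : ℝ) • w - v)
    have h2 := hle ((2 : ℝ) • w - v)
    rw [add_sub_cancel, hR.factor_pos_hom hL hS 2 two_pos] at h1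
    have h3 : y + L ((2 : ℝ) • w - v - w) = y - L (v - w) := by
      rw [sub_eq_add_neg y, ← map_neg]
      congr 2
      module
    rw [h3] at h2
    simp only [Function.comp_apply]
    linarith
  · simp [hRS]
    ring
  · simp [hRS]

end IsAssetRiskMeasure

/-- for the minimizer w* of Γ_g and the unique point y*(w*) attaining
S(w*), every y ∈ y*(w*) + Im(β)^⊥ with Σᵢ yᵢ > 0 normalizes to a solution θ of the
Factor Risk Budgeting problem FRB_b: w = βᵀθ has positive coordinates and
wᵢ ∂ᵢS(w) = bᵢ S(w) for all i. -/
theorem stmt_18 {d m : ℕ} (hm : 1 ≤ m) (hmd : m < d)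
    (R : (Fin d → ℝ) → ℝ) (hR : IsAssetRiskMeasure R)
    (β : Matrix (Fin d) (Fin m) ℝ) (hrank : β.rank = m)
    (S : (Fin m → ℝ) → ℝ)
    (hS : ∀ w, S w = sInf (R '' {y : Fin d → ℝ | βᵀ *ᵥ y = w}))
    (b : Fin m → ℝ) (hb : ∀ i, 0 < b i) (hb1 : ∑ i, b i = 1)
    (g : ℝ → ℝ) (hg1 : ContDiffOn ℝ 1 g (Set.Ici 0))
    (hg2 : ConvexOn ℝ (Set.Ici 0) g) (hg3 : StrictMonoOn g (Set.Ici 0))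
    (wstar : Fin m → ℝ) (hwpos : ∀ i, 0 < wstar i)
    (hwmin : ∀ v : Fin m → ℝ, (∀ i, 0 < v i) →
      g (S wstar) - ∑ i, b i * Real.log (wstar i) ≤ g (S v) - ∑ i, b i * Real.log (v i))
    (ystar : Fin d → ℝ) (hystar : βᵀ *ᵥ ystar = wstar ∧ R ystar = S wstar ∧
      ∀ y : Fin d → ℝ, βᵀ *ᵥ y = wstar → R y = S wstar → y = ystar) :
    ∀ y : Fin d → ℝ, βᵀ *ᵥ (y - ystar) = 0 → 0 < ∑ i, y i →
      ∀ θ : Fin d → ℝ, θ = (∑ i, y i)⁻¹ • y →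
        (∑ i, θ i = 1) ∧ (∀ i, 0 < (βᵀ *ᵥ θ) i) ∧
          ∀ i, (βᵀ *ᵥ θ) i * fderiv ℝ S (βᵀ *ᵥ θ) (Pi.single i 1)
            = b i * S (βᵀ *ᵥ θ) := by
  intro y hy hsum θ hθ
  obtain ⟨hβy, hRS, -⟩ := hystar
  obtain ⟨L, hL⟩ := β.exists_rightInverse_mulVec_transpose hrank
  have hom := hR.factor_pos_hom hL hS
  have hw : βᵀ *ᵥ θ = (∑ i, y i)⁻¹ • wstar := by
    rw [Matrix.mulVec_sub, sub_eq_zero] at hy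
    rw [hθ, Matrix.mulVec_smul, hy, hβy]
  have hc : 0 < (∑ i, y i)⁻¹ := inv_pos.2 hsum
  have hy0 : ystar ≠ 0 := by
    rintro rfl
    have h := hwpos ⟨0, hm⟩
    simp [← hβy] at h
  have hSpos : 0 < S wstar := hRS ▸ hR.pos ystar hy0
  have hA := (hR.factor_differentiableAt hL hS hy0 hβy hRS).hasFDerivAt
  have hEuler := hA.apply_self_of_pos_hom hom
  set A := fderiv ℝ S wstar
  have hg := ((hg1.contDiffAt (Ici_mem_nhds hSpos)).differentiableAt one_ne_zero).hasDerivAt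
  have hlog : HasFDerivAt (fun v : Fin m → ℝ => ∑ i, b i * Real.log (v i))
      (∑ i, b i • (wstar i)⁻¹ • ContinuousLinearMap.proj (R := ℝ) i) wstar :=
    HasFDerivAt.fun_sum fun i _ =>
      (HasFDerivAt.log (hasFDerivAt_apply i wstar) (hwpos i).ne').const_mul (b i)
  have hΓ := (hg.comp_hasFDerivAt wstar hA).sub hlog
  have hmin : IsLocalMin
      (g ∘ S - fun v : Fin m → ℝ => ∑ i, b i * Real.log (v i)) wstar := by
    have hpos : ∀ᶠ v in nhds wstar, ∀ i, 0 < v i :=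
      Filter.eventually_all.2 fun i =>
        (continuous_apply i).continuousAt.eventually (lt_mem_nhds (hwpos i))
    filter_upwards [hpos] with v hv using hwmin v hv
  have hzero := hmin.hasFDerivAt_eq_zero hΓ
  set γ := deriv g (S wstar)
  have hi : ∀ i, wstar i * (γ * A (Pi.single i 1)) = b i := by
    intro i
    have h := DFunLike.congr_fun hzero (Pi.single i 1)
    simp [Pi.single_apply, sub_eq_zero] at h
    rw [h]
    field_simp [(hwpos i).ne']
  have hAsum : ∑ i, wstar i * A (Pi.single i 1) = S wstar := by
    rw [← hEuler]
    conv_rhs => rw [pi_eq_sum_univ' wstar, map_sum]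
    simp
  have hγ : γ * S wstar = 1 := by
    rw [← hb1, ← hAsum, Finset.mul_sum]
    exact Finset.sum_congr rfl fun i _ => by rw [← hi i]; ring
  refine ⟨?_, fun i => ?_, fun i => ?_⟩
  · simp [hθ, ← Finset.mul_sum, hsum.ne']
  · rw [hw]
    exact mul_pos hc (hwpos i)
  · rw [hw, (hA.smul_of_pos_hom hom hc).fderiv, hom _ hc, Pi.smul_apply, smul_eq_mul]
    linear_combination (∑ i, y i)⁻¹ * (S wstar * hi i - wstar i * A (Pi.single i 1) * hγ)
end
end
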